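/- Let C be a braided monoidal category and (A, t₁, t₂, e) a multiplier bimonoid in C with m = (e⊗1)∘t₁ = (1⊗e)∘t₂. Define d₁ := (m⊗1)∘(c⁻¹⊗1)∘(1⊗t₁)∘(c⊗1) : A⊗(A⊗A) → A⊗A and d₂ := (1⊗m)∘(1⊗c⁻¹)∘(t₂⊗1)∘(1⊗c) : (A⊗A)⊗A → A⊗A. Then (f₁, f₂) := (d₁, d₂) satisfies the first defining condition of a morphism A ⇸ A⊗A in the category M: d₁∘(m⊗1_{A⊗A}) = d₁∘(1_A⊗d₁) as morphisms A⊗A⊗(A⊗A) → A⊗A. -/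

import Mathlib

open CategoryTheory MonoidalCategory

variable {C : Type*} [CategoryTheory.Category C] [MonoidalCategory C]

/-- The fusion equation for `t : A ⊗ A ⟶ A ⊗ A`, relative to a chosen braiding
`b : A ⊗ A ≅ A ⊗ A` on `A`:
`(1 ⊗ t) ∘ (t ⊗ 1) = (t ⊗ 1) ∘ (b⁻¹ ⊗ 1) ∘ (1 ⊗ t) ∘ (b ⊗ 1) ∘ (1 ⊗ t)`. -/
def IsFusion (A : C) (b : A ⊗ A ≅ A ⊗ A) (t : A ⊗ A ⟶ A ⊗ A) : Prop :=
  (t ▷ A) ≫ (α_ A A A).hom ≫ (A ◁ t) =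
    (α_ A A A).hom ≫ (A ◁ t) ≫ (α_ A A A).inv ≫ (b.hom ▷ A) ≫ (α_ A A A).hom ≫
      (A ◁ t) ≫ (α_ A A A).inv ≫ (b.inv ▷ A) ≫ (t ▷ A) ≫ (α_ A A A).hom

/-- The fusion equation in the reversed monoidal category, relative to a chosen
braiding `b`: `(t ⊗ 1) ∘ (1 ⊗ t) = (1 ⊗ t) ∘ (1 ⊗ b⁻¹) ∘ (t ⊗ 1) ∘ (1 ⊗ b) ∘ (t ⊗ 1)`. -/
def IsRevFusion (A : C) (b : A ⊗ A ≅ A ⊗ A) (t : A ⊗ A ⟶ A ⊗ A) : Prop :=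
  (α_ A A A).hom ≫ (A ◁ t) ≫ (α_ A A A).inv ≫ (t ▷ A) =
    (t ▷ A) ≫ (α_ A A A).hom ≫ (A ◁ b.hom) ≫ (α_ A A A).inv ≫ (t ▷ A) ≫
      (α_ A A A).hom ≫ (A ◁ b.inv) ≫ (A ◁ t) ≫ (α_ A A A).inv

/-- A multiplier bimonoid structure `(A, t₁, t₂, e)` relative to a chosen braiding `b`
on `A`: `t₁` is a fusion morphism, `t₂` a fusion morphism in the reverse category,
`e` is a common counit, and the two diagrams of equation (3.3) commute. -/
def IsMultiplierBimonoid (A : C) (b : A ⊗ A ≅ A ⊗ A) (t₁ t₂ : A ⊗ A ⟶ A ⊗ A)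
    (e : A ⟶ 𝟙_ C) : Prop :=
  IsFusion A b t₁ ∧ IsRevFusion A b t₂ ∧
    (t₁ ≫ (A ◁ e) ≫ (ρ_ A).hom = (A ◁ e) ≫ (ρ_ A).hom) ∧
    (t₂ ≫ (e ▷ A) ≫ (λ_ A).hom = (e ▷ A) ≫ (λ_ A).hom) ∧
    ((t₂ ▷ A) ≫ (α_ A A A).hom ≫ (A ◁ t₁) =
      (α_ A A A).hom ≫ (A ◁ t₁) ≫ (α_ A A A).inv ≫ (t₂ ▷ A) ≫ (α_ A A A).hom) ∧
    (t₁ ≫ (e ▷ A) ≫ (λ_ A).hom = t₂ ≫ (A ◁ e) ≫ (ρ_ A).hom)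

/-- `f` applied to the first two factors of a right-associated triple tensor product. -/
def onFirstTwo {X Y X' Y' : C} (f : X ⊗ Y ⟶ X' ⊗ Y') (Z : C) : X ⊗ (Y ⊗ Z) ⟶ X' ⊗ (Y' ⊗ Z) :=
  (α_ X Y Z).inv ≫ (f ▷ Z) ≫ (α_ X' Y' Z).hom

/-- A binary operation applied to the first two factors of a right-associated triple
tensor product. -/
def mulFirstTwo {X Y W : C} (m : X ⊗ Y ⟶ W) (Z : C) : X ⊗ (Y ⊗ Z) ⟶ W ⊗ Z :=
  (α_ X Y Z).inv ≫ (m ▷ Z)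

theorem onFirstTwo_comp_whiskerLeft {X Y X' Y' Z Z' : C} (f : X ⊗ Y ⟶ X' ⊗ Y') (g : Z ⟶ Z') :
    onFirstTwo f Z ≫ (X' ◁ Y' ◁ g) = (X ◁ Y ◁ g) ≫ onFirstTwo f Z' := by
  have h : f ▷ Z ≫ ((X' ⊗ Y') ◁ g) = ((X ⊗ Y) ◁ g) ≫ f ▷ Z' := (whisker_exchange f g).symm
  simp only [tensor_whiskerLeft, Category.assoc] at h
  rw [← cancel_mono (α_ X' Y' Z').inv, ← cancel_epi (α_ X Y Z).hom]
  simpa [onFirstTwo] using h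

theorem mulFirstTwo_comp_whiskerLeft {X Y W Z Z' : C} (m : X ⊗ Y ⟶ W) (g : Z ⟶ Z') :
    mulFirstTwo m Z ≫ (W ◁ g) = (X ◁ Y ◁ g) ≫ mulFirstTwo m Z' := by
  simp [mulFirstTwo, ← whisker_exchange]

theorem onFirstTwo_hom_inv {X Y X' Y' : C} (b : X ⊗ Y ≅ X' ⊗ Y') (Z : C) :
    onFirstTwo b.hom Z ≫ onFirstTwo b.inv Z = 𝟙 _ := by
  simp [onFirstTwo]

theorem onFirstTwo_inv_hom {X Y X' Y' : C} (b : X ⊗ Y ≅ X' ⊗ Y') (Z : C) :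
    onFirstTwo b.inv Z ≫ onFirstTwo b.hom Z = 𝟙 _ := by
  simp [onFirstTwo]

/-- The isomorphism version of `onFirstTwo`. -/
def onFirstTwoIso {X Y X' Y' : C} (b : X ⊗ Y ≅ X' ⊗ Y') (Z : C) :
    X ⊗ (Y ⊗ Z) ≅ X' ⊗ (Y' ⊗ Z) where
  hom := onFirstTwo b.hom Z
  inv := onFirstTwo b.inv Z
  hom_inv_id := onFirstTwo_hom_inv b Z
  inv_hom_id := onFirstTwo_inv_hom b Z

section Braided

variable [BraidedCategory C]

theorem whiskerLeft_mulFirstTwo_comp_braiding {X Y W V : C} (m : X ⊗ Y ⟶ W) (Z : C) :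
    (V ◁ mulFirstTwo m Z) ≫ onFirstTwo (β_ V W).hom Z =
      onFirstTwo (β_ V X).hom (Y ⊗ Z) ≫ (X ◁ onFirstTwo (β_ V Y).hom Z) ≫
        mulFirstTwo m (V ⊗ Z) := by
  have h := congrArg (fun f => f ▷ Z) (BraidedCategory.braiding_naturality_right V m)
  simp only [BraidedCategory.braiding_tensor_right_hom, comp_whiskerRight] at h
  have h' : (V ◁ mulFirstTwo m Z) ≫ onFirstTwo (β_ V W).hom Z =
      (V ◁ (α_ X Y Z).inv) ≫ (α_ V (X ⊗ Y) Z).inv ≫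
        ((V ◁ m) ▷ Z ≫ (β_ V W).hom ▷ Z) ≫ (α_ W V Z).hom := by
    simp only [mulFirstTwo, onFirstTwo]
    monoidal
  rw [h', h]
  simp only [mulFirstTwo, onFirstTwo]
  monoidal

theorem mulFirstTwo_comp_braiding {X Y W V : C} (m : X ⊗ Y ⟶ W) (Z : C) :
    mulFirstTwo m (V ⊗ Z) ≫ onFirstTwo (β_ W V).hom Z =
      (X ◁ onFirstTwo (β_ Y V).hom Z) ≫ onFirstTwo (β_ X V).hom (Y ⊗ Z) ≫
        (V ◁ mulFirstTwo m Z) := by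
  have h := congrArg (fun f => f ▷ Z) (BraidedCategory.braiding_naturality_left m V)
  simp only [BraidedCategory.braiding_tensor_left_hom, comp_whiskerRight] at h
  have h' : mulFirstTwo m (V ⊗ Z) ≫ onFirstTwo (β_ W V).hom Z =
      (α_ X Y (V ⊗ Z)).inv ≫ (α_ (X ⊗ Y) V Z).inv ≫
        (m ▷ V ▷ Z ≫ (β_ W V).hom ▷ Z) ≫ (α_ V W Z).hom := by
    simp only [mulFirstTwo, onFirstTwo]
    monoidal
  rw [h', h]
  simp only [mulFirstTwo, onFirstTwo]
  monoidal

theorem mulFirstTwo_comp_braiding_inv {X Y W V : C} (m : X ⊗ Y ⟶ W) (Z : C) :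
    mulFirstTwo m (V ⊗ Z) ≫ onFirstTwo (β_ V W).inv Z =
      (X ◁ onFirstTwo (β_ V Y).inv Z) ≫ onFirstTwo (β_ V X).inv (Y ⊗ Z) ≫
        (V ◁ mulFirstTwo m Z) := by
  have h := whiskerLeft_mulFirstTwo_comp_braiding (V := V) m Z
  change (V ◁ mulFirstTwo m Z) ≫ (onFirstTwoIso (β_ V W) Z).hom =
      (onFirstTwoIso (β_ V X) (Y ⊗ Z)).hom ≫ (whiskerLeftIso X (onFirstTwoIso (β_ V Y) Z)).hom ≫
        mulFirstTwo m (V ⊗ Z) at h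
  change mulFirstTwo m (V ⊗ Z) ≫ (onFirstTwoIso (β_ V W) Z).inv =
      (whiskerLeftIso X (onFirstTwoIso (β_ V Y) Z)).inv ≫ (onFirstTwoIso (β_ V X) (Y ⊗ Z)).inv ≫
        (V ◁ mulFirstTwo m Z)
  rw [Iso.comp_inv_eq, Category.assoc, Category.assoc, Iso.eq_inv_comp, Iso.eq_inv_comp, h]

theorem whiskerLeft_mulFirstTwo_comp_braiding_inv {X Y W V : C} (m : X ⊗ Y ⟶ W) (Z : C) :
    (V ◁ mulFirstTwo m Z) ≫ onFirstTwo (β_ W V).inv Z =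
      onFirstTwo (β_ X V).inv (Y ⊗ Z) ≫ (X ◁ onFirstTwo (β_ Y V).inv Z) ≫
        mulFirstTwo m (V ⊗ Z) := by
  have h := mulFirstTwo_comp_braiding (V := V) m Z
  change mulFirstTwo m (V ⊗ Z) ≫ (onFirstTwoIso (β_ W V) Z).hom =
      (whiskerLeftIso X (onFirstTwoIso (β_ Y V) Z)).hom ≫ (onFirstTwoIso (β_ X V) (Y ⊗ Z)).hom ≫
        (V ◁ mulFirstTwo m Z) at h
  change (V ◁ mulFirstTwo m Z) ≫ (onFirstTwoIso (β_ W V) Z).inv =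
      (onFirstTwoIso (β_ X V) (Y ⊗ Z)).inv ≫ (whiskerLeftIso X (onFirstTwoIso (β_ Y V) Z)).inv ≫
        mulFirstTwo m (V ⊗ Z)
  rw [Iso.comp_inv_eq, Category.assoc, Category.assoc, Iso.eq_inv_comp, Iso.eq_inv_comp, h]

theorem onFirstTwo_yang_baxter (X Y V Z : C) :
    onFirstTwo (β_ X Y).hom (V ⊗ Z) ≫ (Y ◁ onFirstTwo (β_ X V).hom Z) ≫
        onFirstTwo (β_ Y V).hom (X ⊗ Z) =
      (X ◁ onFirstTwo (β_ Y V).hom Z) ≫ onFirstTwo (β_ X V).hom (Y ⊗ Z) ≫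
        (V ◁ onFirstTwo (β_ X Y).hom Z) := by
  have h := congrArg (fun f => f ▷ Z) (BraidedCategory.yang_baxter X Y V)
  have h' : onFirstTwo (β_ X Y).hom (V ⊗ Z) ≫ (Y ◁ onFirstTwo (β_ X V).hom Z) ≫
        onFirstTwo (β_ Y V).hom (X ⊗ Z) = X ◁ (α_ Y V Z).inv ≫ (α_ X (Y ⊗ V) Z).inv ≫
      (((α_ X Y V).inv ≫ (β_ X Y).hom ▷ V ≫ (α_ Y X V).hom ≫
      Y ◁ (β_ X V).hom ≫ (α_ Y V X).inv ≫ (β_ Y V).hom ▷ X ≫ (α_ V Y X).hom) ▷ Z) ≫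
      (α_ V (Y ⊗ X) Z).hom ≫ V ◁ (α_ Y X Z).hom := by
    simp only [onFirstTwo]
    monoidal
  rw [h', h]
  simp only [onFirstTwo]
  monoidal

theorem onFirstTwo_yang_baxter_conj (X Y V Z : C) :
    onFirstTwo (β_ X Y).hom (V ⊗ Z) ≫ (Y ◁ onFirstTwo (β_ X V).hom Z) ≫
        onFirstTwo (β_ V Y).inv (X ⊗ Z) =
      (X ◁ onFirstTwo (β_ V Y).inv Z) ≫ onFirstTwo (β_ X V).hom (Y ⊗ Z) ≫
        (V ◁ onFirstTwo (β_ X Y).hom Z) := by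
  have h := onFirstTwo_yang_baxter X V Y Z
  change _ = (whiskerLeftIso X (onFirstTwoIso (β_ V Y) Z)).hom ≫ _ at h
  change _ ≫ _ ≫ (onFirstTwoIso (β_ V Y) (X ⊗ Z)).inv =
    (whiskerLeftIso X (onFirstTwoIso (β_ V Y) Z)).inv ≫ _
  rw [← Category.assoc, Iso.comp_inv_eq, Category.assoc, Iso.eq_inv_comp, ← h]
  simp only [Category.assoc]
  rfl

theorem onFirstTwo_yang_baxter_inv (X Y V Z : C) :
    (V ◁ onFirstTwo (β_ X Y).inv Z) ≫ onFirstTwo (β_ X V).inv (Y ⊗ Z) ≫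
        (X ◁ onFirstTwo (β_ Y V).inv Z) =
      onFirstTwo (β_ Y V).inv (X ⊗ Z) ≫ (Y ◁ onFirstTwo (β_ X V).inv Z) ≫
        onFirstTwo (β_ X Y).inv (V ⊗ Z) := by
  have h : onFirstTwoIso (β_ X Y) (V ⊗ Z) ≪≫ whiskerLeftIso Y (onFirstTwoIso (β_ X V) Z) ≪≫
        onFirstTwoIso (β_ Y V) (X ⊗ Z) =
      whiskerLeftIso X (onFirstTwoIso (β_ Y V) Z) ≪≫ onFirstTwoIso (β_ X V) (Y ⊗ Z) ≪≫
        whiskerLeftIso V (onFirstTwoIso (β_ X Y) Z) :=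
    Iso.ext (onFirstTwo_yang_baxter X Y V Z)
  simpa [onFirstTwoIso] using (congrArg Iso.inv h).symm

end Braided

/-- A fusion morphism intertwines the multiplication it induces: `t ∘ (m ⊗ 1)` factors through
`1 ⊗ t`. -/
theorem IsFusion.mulFirstTwo_comp {A : C} {b : A ⊗ A ≅ A ⊗ A} {t : A ⊗ A ⟶ A ⊗ A}
    (h : IsFusion A b t) {e : A ⟶ 𝟙_ C} {m : A ⊗ A ⟶ A}
    (hm : m = t ≫ (e ▷ A) ≫ (λ_ A).hom) :
    mulFirstTwo m A ≫ t =
      (A ◁ t) ≫ onFirstTwo b.hom A ≫ (A ◁ t) ≫ onFirstTwo b.inv A ≫ mulFirstTwo m A := by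
  have h₁ := congrArg (fun f => (α_ A A A).inv ≫ f ≫ (e ▷ (A ⊗ A)) ≫ (λ_ (A ⊗ A)).hom) h
  simp only [Category.assoc, Iso.inv_hom_id_assoc] at h₁
  have h₂ : mulFirstTwo m A ≫ t = (α_ A A A).inv ≫ t ▷ A ≫ (α_ A A A).hom ≫ A ◁ t ≫
      e ▷ (A ⊗ A) ≫ (λ_ (A ⊗ A)).hom := by
    rw [whisker_exchange_assoc, leftUnitor_naturality, hm]
    simp only [mulFirstTwo]
    monoidal
  rw [h₂, h₁, hm]
  simp only [mulFirstTwo, onFirstTwo]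
  monoidal

theorem mulFirstTwo_assoc {A : C} {m : A ⊗ A ⟶ A} (h : mulFirstTwo m A ≫ m = (A ◁ m) ≫ m)
    (Z : C) :
    mulFirstTwo m (A ⊗ Z) ≫ mulFirstTwo m Z = (A ◁ mulFirstTwo m Z) ≫ mulFirstTwo m Z := by
  have h₁ : mulFirstTwo m (A ⊗ Z) ≫ mulFirstTwo m Z =
      (A ◁ (α_ A A Z).inv) ≫ (α_ A (A ⊗ A) Z).inv ≫ ((mulFirstTwo m A ≫ m) ▷ Z) := by
    simp only [mulFirstTwo]
    monoidal
  rw [h₁, h]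
  simp only [mulFirstTwo]
  monoidal

theorem onFirstTwo_braiding_comp_counit [BraidedCategory C] {A B : C} (e : A ⟶ 𝟙_ C) (Z : C) :
    onFirstTwo (β_ B A).hom Z ≫ (e ▷ (B ⊗ Z)) ≫ (λ_ (B ⊗ Z)).hom =
      B ◁ ((e ▷ Z) ≫ (λ_ Z).hom) := by
  have h := congrArg (fun f => (α_ B A Z).inv ≫ (f ≫ (λ_ B).hom) ▷ Z)
    (BraidedCategory.braiding_naturality_right B e)
  simp only [braiding_tensorUnit_right] at h
  have h' : onFirstTwo (β_ B A).hom Z ≫ (e ▷ (B ⊗ Z)) ≫ (λ_ (B ⊗ Z)).hom =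
      (α_ B A Z).inv ≫ (((β_ B A).hom ≫ e ▷ B) ≫ (λ_ B).hom) ▷ Z := by
    simp only [onFirstTwo]
    monoidal
  rw [h', ← h]
  monoidal

theorem onFirstTwo_braiding_inv_comp_counit [BraidedCategory C] {A B : C} (e : A ⟶ 𝟙_ C)
    (Z : C) :
    onFirstTwo (β_ B A).inv Z ≫ (B ◁ ((e ▷ Z) ≫ (λ_ Z).hom)) =
      (e ▷ (B ⊗ Z)) ≫ (λ_ (B ⊗ Z)).hom := by
  rw [← onFirstTwo_braiding_comp_counit, reassoc_of% (onFirstTwo_inv_hom (β_ B A) Z)]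

theorem IsFusion.mul_assoc [BraidedCategory C] {A : C} {t : A ⊗ A ⟶ A ⊗ A}
    (h : IsFusion A (β_ A A) t) {e : A ⟶ 𝟙_ C} {m : A ⊗ A ⟶ A}
    (he : t ≫ (A ◁ e) ≫ (ρ_ A).hom = (A ◁ e) ≫ (ρ_ A).hom)
    (hm : m = t ≫ (e ▷ A) ≫ (λ_ A).hom) :
    mulFirstTwo m A ≫ m = (A ◁ m) ≫ m := by
  have hme : m ≫ e = (A ◁ e) ≫ (ρ_ A).hom ≫ e := by
    rw [← reassoc_of% he, hm, ← rightUnitor_naturality, whisker_exchange_assoc,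
      Category.assoc, Category.assoc, ← leftUnitor_naturality, unitors_equal]
  have h₁ : mulFirstTwo m A ≫ (e ▷ A) ≫ (λ_ A).hom =
      (A ◁ ((e ▷ A) ≫ (λ_ A).hom)) ≫ (e ▷ A) ≫ (λ_ A).hom := by
    have h₂ : mulFirstTwo m A ≫ (e ▷ A) ≫ (λ_ A).hom =
        (α_ A A A).inv ≫ ((m ≫ e) ▷ A) ≫ (λ_ A).hom := by
      simp [mulFirstTwo]
    rw [h₂, hme]
    monoidal
  have h₂ : mulFirstTwo m A ≫ m = mulFirstTwo m A ≫ t ≫ (e ▷ A) ≫ (λ_ A).hom := by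
    rw [← hm]
  rw [h₂, reassoc_of% (h.mulFirstTwo_comp hm), h₁,
    reassoc_of% (onFirstTwo_braiding_inv_comp_counit (B := A) e A),
    whisker_exchange_assoc, leftUnitor_naturality_assoc,
    reassoc_of% (onFirstTwo_braiding_comp_counit (B := A) e A), ← whiskerLeft_comp_assoc, ← hm]

/-- For a multiplier bimonoid `(A, t₁, t₂, e)` in a braided monoidal
category with `m = (e⊗1)∘t₁ = (1⊗e)∘t₂`, the comultiplication components
`d₁ = (m⊗1)∘(c⁻¹⊗1)∘(1⊗t₁)∘(c⊗1) : A⊗(A⊗A) ⟶ A⊗A` and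
`d₂ = (1⊗m)∘(1⊗c⁻¹)∘(t₂⊗1)∘(1⊗c) : (A⊗A)⊗A ⟶ A⊗A` satisfy the first defining
condition of a morphism `A ⇸ A ⊗ A` in the category `ℳ`:
`d₁ ∘ (m ⊗ 1) = d₁ ∘ (1 ⊗ d₁)`. -/
theorem comultiplication_first_morphism_condition {C : Type*} [CategoryTheory.Category C]
    [MonoidalCategory C] [BraidedCategory C]
    (A : C) (t₁ t₂ : A ⊗ A ⟶ A ⊗ A) (e : A ⟶ 𝟙_ C) (m : A ⊗ A ⟶ A)
    (h : IsMultiplierBimonoid A (β_ A A) t₁ t₂ e)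
    (hm : m = t₁ ≫ (e ▷ A) ≫ (λ_ A).hom)
    (d₁ : A ⊗ (A ⊗ A) ⟶ A ⊗ A)
    (hd₁ : d₁ = (α_ A A A).inv ≫ ((β_ A A).hom ▷ A) ≫ (α_ A A A).hom ≫ (A ◁ t₁) ≫
      (α_ A A A).inv ≫ ((β_ A A).inv ▷ A) ≫ (m ▷ A))
    (d₂ : (A ⊗ A) ⊗ A ⟶ A ⊗ A)
    (hd₂ : d₂ = (α_ A A A).hom ≫ (A ◁ (β_ A A).hom) ≫ (α_ A A A).inv ≫ (t₂ ▷ A) ≫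
      (α_ A A A).hom ≫ (A ◁ (β_ A A).inv) ≫ (A ◁ m)) :
    (m ▷ (A ⊗ A)) ≫ d₁ = (α_ A A (A ⊗ A)).hom ≫ (A ◁ d₁) ≫ d₁ := by
  obtain ⟨hf, -, he, -, -, -⟩ := h
  have hd : d₁ = onFirstTwo (β_ A A).hom A ≫ (A ◁ t₁) ≫ onFirstTwo (β_ A A).inv A ≫
      mulFirstTwo m A := by
    simp [hd₁, onFirstTwo, mulFirstTwo]
  have hl : (α_ A A (A ⊗ A)).inv ≫ (m ▷ (A ⊗ A)) ≫ d₁ = (A ◁ d₁) ≫ d₁ := by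
    have hmt : mulFirstTwo m A ≫ t₁ = (A ◁ t₁) ≫ d₁ := by
      rw [hd, hf.mulFirstTwo_comp hm]
    have hassoc := fun (Z : C) => mulFirstTwo_assoc (hf.mul_assoc he hm) Z
    have hyb₁ := onFirstTwo_yang_baxter_conj A A A A
    have hyb₂ := onFirstTwo_yang_baxter_inv A A A A
    have hlhs : mulFirstTwo m (A ⊗ A) ≫ d₁ =
        (A ◁ onFirstTwo (β_ A A).hom A) ≫ (A ◁ A ◁ t₁) ≫ onFirstTwo (β_ A A).hom (A ⊗ A) ≫
          (A ◁ onFirstTwo (β_ A A).hom A) ≫ (A ◁ A ◁ t₁) ≫ (A ◁ onFirstTwo (β_ A A).inv A) ≫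
          onFirstTwo (β_ A A).inv (A ⊗ A) ≫ (A ◁ onFirstTwo (β_ A A).inv A) ≫
          (A ◁ mulFirstTwo m A) ≫ mulFirstTwo m A := by
      conv_lhs => rw [hd]
      rw [reassoc_of% (mulFirstTwo_comp_braiding (V := A) m A), ← whiskerLeft_comp_assoc, hmt, hd]
      simp only [whiskerLeft_comp, Category.assoc]
      rw [reassoc_of% (whiskerLeft_mulFirstTwo_comp_braiding_inv (V := A) m A), hassoc,
        reassoc_of% (onFirstTwo_comp_whiskerLeft (β_ A A).hom t₁)]
    have hrhs : (A ◁ d₁) ≫ d₁ =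
        (A ◁ onFirstTwo (β_ A A).hom A) ≫ (A ◁ A ◁ t₁) ≫ (A ◁ onFirstTwo (β_ A A).inv A) ≫
          onFirstTwo (β_ A A).hom (A ⊗ A) ≫ (A ◁ onFirstTwo (β_ A A).hom A) ≫ (A ◁ A ◁ t₁) ≫
          (A ◁ onFirstTwo (β_ A A).inv A) ≫ onFirstTwo (β_ A A).inv (A ⊗ A) ≫
          (A ◁ mulFirstTwo m A) ≫ mulFirstTwo m A := by
      rw [hd]
      simp only [whiskerLeft_comp, Category.assoc]
      rw [reassoc_of% (whiskerLeft_mulFirstTwo_comp_braiding (V := A) m A),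
        reassoc_of% (mulFirstTwo_comp_whiskerLeft m t₁),
        reassoc_of% (mulFirstTwo_comp_braiding_inv (V := A) m A)]
    have hlm : (α_ A A (A ⊗ A)).inv ≫ (m ▷ (A ⊗ A)) ≫ d₁ = mulFirstTwo m (A ⊗ A) ≫ d₁ := by
      simp [mulFirstTwo]
    rw [hlm, hlhs, hrhs, reassoc_of% hyb₂,
      ← reassoc_of% (onFirstTwo_comp_whiskerLeft (β_ A A).inv t₁), reassoc_of% hyb₁]
  rw [← hl, Iso.hom_inv_id_assoc]
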